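/- For every n ≥ 0, every flag triangulation of the n-sphere S^n has at least 2n+2 vertices, and, up to combinatorial isomorphism, there is exactly one flag triangulation of S^n with exactly 2n+2 vertices: the octahedral n-sphere, i.e., the (n+1)-fold join S⁰ ⋆ S⁰ ⋆ ⋯ ⋆ S⁰, where S⁰ is the simplicial complex with two vertices and no 1-simplex. -/

import Mathlib

open scoped Classical

noncomputable section

/-- A family of finsets of `V` is an abstract simplicial complex on the vertex set `V`:
it contains the empty set and all singletons, and is closed under taking subsets. -/
def IsComplex {V : Type*} (F : Set (Finset V)) : Prop :=
  ∅ ∈ F ∧ (∀ v : V, ({v} : Finset V) ∈ F) ∧ ∀ σ ∈ F, ∀ τ : Finset V, τ ⊆ σ → τ ∈ F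

/-- `f₀`: the number of vertices (`0`-simplices) of a family of finsets. -/
def fZero {V : Type*} (F : Set (Finset V)) : ℕ := {σ ∈ F | σ.card = 1}.ncard

/-- `f₁`: the number of edges (`1`-simplices) of a family of finsets. -/
def fOne {V : Type*} (F : Set (Finset V)) : ℕ := {σ ∈ F | σ.card = 2}.ncard

/-- `γ₂(T) = 16 - 5·f₀(T) + f₁(T)`, as an integer. -/
def gammaTwo {V : Type*} (F : Set (Finset V)) : ℤ := 16 - 5 * (fZero F : ℤ) + (fOne F : ℤ)

/-- `T` is a flag simplicial complex: every set of vertices that are pairwise joined by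
`1`-simplices of `T` is itself a simplex of `T`. -/
def IsFlag {V : Type*} (F : Set (Finset V)) : Prop :=
  ∀ σ : Finset V, (∀ u ∈ σ, ({u} : Finset V) ∈ F) →
    (∀ u ∈ σ, ∀ w ∈ σ, u ≠ w → ({u, w} : Finset V) ∈ F) → σ ∈ F

/-- `K` is a triangulation of the `n`-sphere: a finite geometric simplicial complex in some
Euclidean space whose underlying space is homeomorphic to the unit sphere of `ℝ^(n+1)`. -/
def IsSphereTriangulation (n : ℕ) {N : ℕ}
    (K : Geometry.SimplicialComplex ℝ (EuclideanSpace ℝ (Fin N))) : Prop :=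
  K.faces.Finite ∧
    Nonempty (↥K.space ≃ₜ ↥(Metric.sphere (0 : EuclideanSpace ℝ (Fin (n + 1))) 1))

/-- The abstract simplicial complex associated to a geometric simplicial complex: its
simplices are the vertex sets of the faces, together with the empty simplex. -/
def abstractFaces {N : ℕ} (K : Geometry.SimplicialComplex ℝ (EuclideanSpace ℝ (Fin N))) :
    Set (Finset (EuclideanSpace ℝ (Fin N))) :=
  insert ∅ K.faces

/-- Combinatorial isomorphism of two families of finsets: a bijection between the vertex
sets inducing a bijection between the simplices. -/
def CombIso {X Y : Type*} (F : Set (Finset X)) (G : Set (Finset Y)) : Prop :=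
  ∃ e : {x : X // ({x} : Finset X) ∈ F} ≃ {y : Y // ({y} : Finset Y) ∈ G},
    ∀ σ : Finset {x : X // ({x} : Finset X) ∈ F},
      σ.image Subtype.val ∈ F ↔ σ.image (fun x => (e x).val) ∈ G

/-- The octahedral `n`-sphere: the `(n+1)`-fold join `S⁰ ⋆ ⋯ ⋆ S⁰`, realized as the complex
on `Fin (n+1) × Bool` whose simplices are the sets containing no antipodal pair. -/
def octFaces (n : ℕ) : Set (Finset (Fin (n + 1) × Bool)) :=
  {σ | ∀ i : Fin (n + 1), ¬ ((i, true) ∈ σ ∧ (i, false) ∈ σ)}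


/-- The determinant of `1 + t A` at `t = 1` is a fixed linear combination of its values at
prescribed nodes. -/
lemma det_interp {E : Type*} [NormedAddCommGroup E] [NormedSpace ℝ E] [FiniteDimensional ℝ E]
    (v : ℕ → ℝ) (hv : Function.Injective v) :
    ∃ c : ℕ → ℝ, (∑ i ∈ Finset.range (Module.finrank ℝ E + 1), c i = 1) ∧
      ∀ A : E →L[ℝ] E, (1 + A).det =
        ∑ i ∈ Finset.range (Module.finrank ℝ E + 1), c i * (1 + v i • A).det := by
  set s := Finset.range (Module.finrank ℝ E + 1) with hs
  have hsne : s.Nonempty := ⟨0, by simp [hs]⟩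
  refine ⟨fun i => (Lagrange.basis s v i).eval 1, ?_, ?_⟩
  · have := congrArg (Polynomial.eval 1) (Lagrange.sum_basis (s := s) (v := v) hv.injOn hsne)
    simpa [Polynomial.eval_finsetSum] using this
  · intro A
    let b := Module.finBasis ℝ E
    let M := LinearMap.toMatrix b b (A : E →ₗ[ℝ] E)
    let P : Polynomial ℝ := Matrix.det ((Polynomial.X : Polynomial ℝ) • M.map Polynomial.C +
      (1 : Matrix _ _ ℝ).map Polynomial.C)
    have hP : ∀ t : ℝ, P.eval t = (1 + t • A).det := by
      intro t
      have h1 : (1 + t • A).det = Matrix.det (1 + t • M) := by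
        rw [ContinuousLinearMap.det, ← LinearMap.det_toMatrix b]
        congr 1
        have : ((1 + t • A : E →L[ℝ] E) : E →ₗ[ℝ] E) = 1 + t • (A : E →ₗ[ℝ] E) := rfl
        rw [this, map_add, map_smul, LinearMap.toMatrix_one]
      rw [h1]
      have h2 := (Polynomial.evalRingHom t).map_det ((Polynomial.X : Polynomial ℝ) • M.map Polynomial.C +
        (1 : Matrix _ _ ℝ).map Polynomial.C)
      rw [Polynomial.coe_evalRingHom] at h2
      rw [h2]
      congr 1
      ext i j
      by_cases hij : i = j
      · subst hij; simp; ring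
      · simp [hij]; ring
    have hdeg : P.degree < s.card := by
      have h := Polynomial.natDegree_det_X_add_C_le M (1 : Matrix _ _ ℝ)
      simp only [Fintype.card_fin] at h
      refine lt_of_le_of_lt Polynomial.degree_le_natDegree ?_
      have : P.natDegree < s.card := by
        simp only [hs, Finset.card_range]; exact Nat.lt_succ_of_le h
      exact_mod_cast this
    have hL := Lagrange.eq_interpolate (s := s) (v := v) hv.injOn hdeg
    have h1 := hP 1
    rw [one_smul] at h1
    rw [← h1, hL, Lagrange.interpolate_apply, Polynomial.eval_finsetSum]
    refine Finset.sum_congr rfl fun i _ => ?_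
    rw [Polynomial.eval_mul, Polynomial.eval_C, hP]
    ring

/-- Extending a Lipschitz map vanishing on the unit sphere by zero. -/
lemma lipschitz_ext {E : Type*} [NormedAddCommGroup E] [NormedSpace ℝ E]
    (h : E → E) (M : ℝ) (hM : 0 ≤ M)
    (hL : ∀ x ∈ Metric.closedBall (0 : E) 1, ∀ y ∈ Metric.closedBall (0 : E) 1,
      ‖h x - h y‖ ≤ M * ‖x - y‖)
    (h0 : ∀ x, ‖x‖ = 1 → h x = 0) :
    ∀ x y, ‖(if ‖x‖ < 1 then h x else 0) - (if ‖y‖ < 1 then h y else 0)‖ ≤ M * ‖x - y‖ := by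
  have key : ∀ x y : E, ‖x‖ < 1 → ¬ ‖y‖ < 1 → ‖h x‖ ≤ M * ‖x - y‖ := by
    intro x y hx hy
    have hc : ContinuousOn (fun t : ℝ => ‖x + t • (y - x)‖) (Set.Icc 0 1) := by fun_prop
    have hm : (1 : ℝ) ∈ Set.Icc ‖x + (0 : ℝ) • (y - x)‖ ‖x + (1 : ℝ) • (y - x)‖ := by
      constructor
      · simpa using hx.le
      · simpa using hy
    obtain ⟨t, ht, ht1⟩ := intermediate_value_Icc zero_le_one hc hm
    simp only at ht1
    have := hL x (by simpa using hx.le) (x + t • (y - x)) (by simp [ht1])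
    rw [h0 _ ht1, sub_zero] at this
    refine this.trans (mul_le_mul_of_nonneg_left ?_ hM)
    have e : x - (x + t • (y - x)) = t • (x - y) := by rw [smul_sub, smul_sub]; abel
    rw [e, norm_smul, Real.norm_of_nonneg ht.1]
    exact mul_le_of_le_one_left (norm_nonneg _) ht.2
  intro x y
  by_cases hx : ‖x‖ < 1 <;> by_cases hy : ‖y‖ < 1
  · simp only [hx, hy, if_true]
    exact hL x (by simpa using hx.le) y (by simpa using hy.le)
  · simpa [hx, hy] using key x y hx hy
  · have := key y x hy hx
    rw [norm_sub_rev] at this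
    simpa [hx, hy] using this
  · simp only [hx, hy, if_false, sub_zero, norm_zero]; positivity

open MeasureTheory in
/-- There is no `C¹` retraction of the unit ball onto the unit sphere. -/
lemma no_smooth_retraction {E : Type*} [NormedAddCommGroup E] [InnerProductSpace ℝ E]
    [FiniteDimensional ℝ E] (H : E → E) (hH : ContDiff ℝ 1 H) (hn : ∀ x, ‖H x‖ = 1)
    (hid : ∀ x, ‖x‖ = 1 → H x = x) : False := by
  let _ : MeasurableSpace E := borel E
  have _ : BorelSpace E := ⟨rfl⟩
  let μ : Measure E := Measure.addHaar
  set h : E → E := fun x => H x - x with hh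
  have hhd : ContDiff ℝ 1 h := hH.sub contDiff_id
  have hdiff : ∀ x, HasFDerivAt h (fderiv ℝ h x) x :=
    fun x => (hhd.differentiable (by norm_num) x).hasFDerivAt
  have hcont : Continuous (fderiv ℝ h) := hhd.continuous_fderiv (by norm_num)
  obtain ⟨M0, hM0⟩ := (isCompact_closedBall (0 : E) 1).exists_bound_of_continuousOn
    hcont.continuousOn
  set M := max M0 0 + 1 with hMdef
  have hMpos : 0 < M := by positivity
  have hM : ∀ x ∈ Metric.closedBall (0 : E) 1, ‖fderiv ℝ h x‖ ≤ M := fun x hx =>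
    (hM0 x hx).trans (by rw [hMdef]; linarith [le_max_left M0 0])
  have hL : ∀ x ∈ Metric.closedBall (0 : E) 1, ∀ y ∈ Metric.closedBall (0 : E) 1,
      ‖h x - h y‖ ≤ M * ‖x - y‖ := fun x hx y hy =>
    (convex_closedBall (0 : E) 1).norm_image_sub_le_of_norm_fderiv_le
      (fun z _ => (hdiff z).differentiableAt) hM hy hx
  have hE := lipschitz_ext h M hMpos.le hL (fun x hx => by simp [hh, hid x hx])
  set k : E → E := fun x => if ‖x‖ < 1 then h x else 0 with hk
  -- positivity of the determinant near the identity
  have hdet : ∀ᶠ A in nhds (1 : E →L[ℝ] E), 0 < A.det := by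
    have hc : Continuous (fun A : E →L[ℝ] E => A.det) := ContinuousLinearMap.continuous_det
    have : (0 : ℝ) < (1 : E →L[ℝ] E).det := by
      have : (1 : E →L[ℝ] E).det = 1 := by
        rw [ContinuousLinearMap.det]; exact LinearMap.det_id
      rw [this]; norm_num
    exact hc.continuousAt.eventually (lt_mem_nhds this)
  obtain ⟨δ, hδ, hδd⟩ := Metric.eventually_nhds_iff.1 hdet
  -- the volume identity for small t
  have small : ∀ t : ℝ, 0 < t → t * M < 1 → t * M < δ →
      IntegrableOn (fun x => (1 + t • fderiv ℝ h x).det) (Metric.ball (0 : E) 1) μ ∧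
      ∫ x in Metric.ball (0 : E) 1, (1 + t • fderiv ℝ h x).det ∂μ =
        μ.real (Metric.ball (0 : E) 1) := by
    intro t ht ht1 ht2
    set g : E → E := fun x => x + t • k x with hg
    have hinj : Function.Injective g := by
      intro x y hxy
      by_contra hne
      have h1 : x - y = t • (k y - k x) := by
        have : x + t • k x = y + t • k y := hxy
        rw [smul_sub, sub_eq_sub_iff_add_eq_add, this, add_comm]
      have h2 : ‖x - y‖ ≤ t * (M * ‖x - y‖) := by
        conv_lhs => rw [h1, norm_smul, Real.norm_of_nonneg ht.le]
        refine mul_le_mul_of_nonneg_left ?_ ht.le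
        rw [norm_sub_rev x y]; exact hE y x
      have h3 : 0 < ‖x - y‖ := norm_pos_iff.2 (sub_ne_zero.2 hne)
      nlinarith
    have hsurj : Function.Surjective g := by
      intro y
      have hc : ContractingWith (Real.toNNReal (t * M)) (fun x => y - t • k x) := by
        refine ⟨by rw [← NNReal.coe_lt_coe, Real.coe_toNNReal _ (by positivity)]; exact_mod_cast ht1, LipschitzWith.of_dist_le_mul fun a b => ?_⟩
        rw [dist_eq_norm, dist_eq_norm]
        have : y - t • k a - (y - t • k b) = t • (k b - k a) := by rw [smul_sub]; abel
        rw [this, norm_smul, Real.norm_of_nonneg ht.le, Real.coe_toNNReal _ (by positivity), mul_assoc]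
        refine mul_le_mul_of_nonneg_left ?_ ht.le
        rw [norm_sub_rev a b]; exact hE b a
      refine ⟨hc.fixedPoint, ?_⟩
      have := hc.fixedPoint_isFixedPt
      have h2 : y - t • k (hc.fixedPoint) = hc.fixedPoint := this
      change hc.fixedPoint + t • k hc.fixedPoint = y
      conv_lhs => rw [← h2]
      rw [h2]
      nth_rewrite 1 [← h2]
      abel
    have hout : ∀ x, ¬ ‖x‖ < 1 → g x = x := by
      intro x hx; simp [hg, hk, hx]
    have himg : g '' Metric.ball (0 : E) 1 = Metric.ball (0 : E) 1 := by
      ext y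
      simp only [Set.mem_image, mem_ball_zero_iff]
      constructor
      · rintro ⟨x, hx, rfl⟩
        by_contra hy
        have := hinj (hout _ hy)
        rw [this] at hy
        exact hy hx
      · intro hy
        obtain ⟨x, hx⟩ := hsurj y
        refine ⟨x, ?_, hx⟩
        by_contra hx'
        rw [hout x hx'] at hx
        exact hx' (hx ▸ hy)
    have hgd : ∀ x ∈ Metric.ball (0 : E) 1,
        HasFDerivWithinAt g (1 + t • fderiv ℝ h x) (Metric.ball (0 : E) 1) x := by
      intro x hx
      have h1 : HasFDerivAt (fun x => x + t • h x) (1 + t • fderiv ℝ h x) x :=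
        (hasFDerivAt_id x).add ((hdiff x).const_smul t)
      refine HasFDerivWithinAt.congr' h1.hasFDerivWithinAt (fun y hy => ?_) hx
      have : ‖y‖ < 1 := by simpa using hy
      simp [hg, hk, this]
    have hpos : ∀ x ∈ Metric.ball (0 : E) 1, 0 < (1 + t • fderiv ℝ h x).det := by
      intro x hx
      apply hδd
      rw [dist_eq_norm, add_sub_cancel_left, norm_smul, Real.norm_of_nonneg ht.le]
      exact (mul_le_mul_of_nonneg_left (hM x (Metric.ball_subset_closedBall hx)) ht.le).trans_lt ht2
    have hcd : Continuous (fun x => (1 + t • fderiv ℝ h x).det) :=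
      ContinuousLinearMap.continuous_det.comp (by fun_prop)
    refine ⟨(hcd.continuousOn.integrableOn_compact (isCompact_closedBall (0 : E) 1)).mono_set
      Metric.ball_subset_closedBall, ?_⟩
    have hcv := integral_image_eq_integral_abs_det_fderiv_smul μ measurableSet_ball hgd
      hinj.injOn (fun _ => (1 : ℝ))
    rw [himg] at hcv
    simp only [smul_eq_mul, mul_one, integral_const, MeasurableSet.univ, measureReal_restrict_apply,
      Set.univ_inter] at hcv
    rw [hcv]
    refine setIntegral_congr_fun measurableSet_ball fun x hx => ?_
    exact (abs_of_pos (hpos x hx)).symm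
  -- nodes
  set r := min (1 / M) (δ / M) with hr
  have hrpos : 0 < r := by positivity
  set v : ℕ → ℝ := fun i => r / (i + 2) with hv
  have hvpos : ∀ i, 0 < v i := fun i => by positivity
  have hvlt : ∀ i, v i < r := fun i => by
    rw [hv]; simp only
    rw [div_lt_iff₀ (by positivity)]
    nlinarith [Nat.cast_nonneg (α := ℝ) i]
  have hvinj : Function.Injective v := by
    intro i j hij
    simp only [hv] at hij
    rw [div_eq_div_iff (by positivity) (by positivity)] at hij
    have := mul_left_cancel₀ hrpos.ne' hij
    have : (j : ℝ) = i := by linarith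
    exact_mod_cast this.symm
  have hsm : ∀ i, _ := fun i => small (v i) (hvpos i)
    (by
      have := (hvlt i).trans_le (min_le_left _ _)
      rwa [lt_div_iff₀ hMpos] at this)
    (by
      have := (hvlt i).trans_le (min_le_right _ _)
      rwa [lt_div_iff₀ hMpos] at this)
  obtain ⟨c, hc1, hc⟩ := det_interp (E := E) v hvinj
  have hzero : ∀ x, (1 + fderiv ℝ h x).det = 0 := by
    intro x
    have hHd : HasFDerivAt H (1 + fderiv ℝ h x) x := by
      have := (hasFDerivAt_id x).add (hdiff x)
      refine this.congr_of_eventuallyEq (Filter.Eventually.of_forall fun y => ?_)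
      simp [hh]
    set B := 1 + fderiv ℝ h x with hB
    have horth : ∀ w, inner ℝ (H x) (B w) = 0 := by
      have h1 : HasFDerivAt (fun y => ‖H y‖ ^ 2) _ x := hHd.norm_sq
      have h2 : (fun y => ‖H y‖ ^ 2) = fun _ => (1 : ℝ) := by funext y; simp [hn]
      rw [h2] at h1
      have h3 := h1.unique (hasFDerivAt_const (1 : ℝ) x)
      intro w
      have := congrArg (fun L => L w) h3
      simpa using this
    by_contra hne
    have hs : LinearMap.range (B : E →ₗ[ℝ] E) = ⊤ := by
      by_contra hcon
      refine hne (LinearMap.det_eq_zero_iff_ker_ne_bot.2 fun hk => hcon ?_)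
      exact LinearMap.ker_eq_bot_iff_range_eq_top.1 hk
    have : H x ∈ LinearMap.range (B : E →ₗ[ℝ] E) := by rw [hs]; trivial
    obtain ⟨w, hw⟩ := this
    have h4 := horth w
    have hw' : B w = H x := hw
    rw [hw', real_inner_self_eq_norm_sq, hn] at h4
    norm_num at h4
  have hfin : (0 : ℝ) = μ.real (Metric.ball (0 : E) 1) := by
    calc (0 : ℝ) = ∫ x in Metric.ball (0 : E) 1, (1 + fderiv ℝ h x).det ∂μ := by simp [hzero]
      _ = ∫ x in Metric.ball (0 : E) 1, ∑ i ∈ Finset.range (Module.finrank ℝ E + 1),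
            c i * (1 + v i • fderiv ℝ h x).det ∂μ := by
          refine integral_congr_ae (Filter.Eventually.of_forall fun x => ?_); exact hc _
      _ = ∑ i ∈ Finset.range (Module.finrank ℝ E + 1),
            c i * μ.real (Metric.ball (0 : E) 1) := by
          rw [integral_finsetSum _ (fun i _ => (hsm i).1.const_mul _)]
          refine Finset.sum_congr rfl fun i _ => ?_
          rw [integral_const_mul, (hsm i).2]
      _ = _ := by rw [← Finset.sum_mul, hc1, one_mul]
  have hp : 0 < μ.real (Metric.ball (0 : E) 1) := by
    rw [Measure.real]
    exact ENNReal.toReal_pos (Metric.measure_ball_pos μ _ one_pos).ne' measure_ball_lt_top.ne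
  linarith

/-- There is no continuous retraction of the unit ball onto the unit sphere. -/
lemma no_retraction {E : Type*} [NormedAddCommGroup E] [InnerProductSpace ℝ E]
    [FiniteDimensional ℝ E] (R : E → E) (hR : ContinuousOn R (Metric.closedBall 0 1))
    (hn : ∀ x, ‖x‖ ≤ 1 → ‖R x‖ = 1) (hid : ∀ x, ‖x‖ = 1 → R x = x) : False := by
  set k : E → E := (Metric.closedBall (0 : E) 1).piecewise (fun x => R x - x) (fun _ => 0) with hk
  have hkc : Continuous k := by
    refine continuous_piecewise (fun x hx => ?_) ?_ continuousOn_const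
    · have : ‖x‖ = 1 := by
        have := Metric.frontier_closedBall_subset_sphere hx
        simpa using this
      simp [hid x this]
    · rw [Metric.isClosed_closedBall.closure_eq]
      exact hR.sub continuousOn_id
  have hk1 : ∀ x, ‖x‖ ≤ 1 → k x = R x - x := fun x hx => by
    rw [hk, Set.piecewise_eq_of_mem _ _ _ (by simpa using hx)]
  have hk2 : ∀ x, ¬ ‖x‖ ≤ 1 → k x = 0 := fun x hx => by
    rw [hk, Set.piecewise_eq_of_notMem _ _ _ (by simpa using hx)]
  obtain ⟨g, hg, hgd, hgs⟩ := hkc.exists_contDiff_approx 1 (ε := fun _ => (1 / 2 : ℝ))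
    continuous_const (fun _ => by norm_num)
  have hF : ∀ x, 1 ≤ ‖x + k x‖ := by
    intro x
    by_cases hx : ‖x‖ ≤ 1
    · rw [hk1 x hx, add_sub_cancel, hn x hx]
    · rw [hk2 x hx, add_zero]; exact (not_le.1 hx).le
  have hG : ∀ x, x + g x ≠ 0 := by
    intro x h0
    have h1 := hgd x
    have h2 := hF x
    rw [dist_eq_norm] at h1
    have h3 : x + k x = -(g x - k x) := by
      have : x = - g x := eq_neg_of_add_eq_zero_left h0
      rw [neg_sub, sub_eq_add_neg, ← this, add_comm]
    rw [h3, norm_neg] at h2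
    linarith
  have hg' : ContDiff ℝ 1 g := hg
  have hGd : ContDiff ℝ 1 (fun x => x + g x) := contDiff_id.add hg'
  refine no_smooth_retraction (fun x => ‖x + g x‖⁻¹ • (x + g x)) ?_ ?_ ?_
  · exact ((hGd.norm ℝ hG).inv (fun x => norm_ne_zero_iff.2 (hG x))).smul hGd
  · intro x
    rw [norm_smul, norm_inv, norm_norm, inv_mul_cancel₀ (norm_ne_zero_iff.2 (hG x))]
  · intro x hx
    have hk0 : k x = 0 := by rw [hk1 x hx.le, hid x hx, sub_self]
    have hg0 : g x = 0 := by
      by_contra hne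
      exact hgs (Function.mem_support.2 hne) hk0
    simp [hg0, hx]

/-- Gluing continuous maps on two closed sets. -/
lemma glue_closed {X Y : Type*} [TopologicalSpace X] [TopologicalSpace Y] {D C : Set X}
    (hD : IsClosed D) (hC : IsClosed C) {f g : X → Y} (hf : ContinuousOn f D)
    (hg : ContinuousOn g C) (hfg : ∀ x ∈ D, x ∈ C → f x = g x) :
    ContinuousOn (D.piecewise f g) (D ∪ C) := by
  refine ContinuousOn.union_of_isClosed ?_ ?_ hD hC
  · exact hf.congr fun x hx => Set.piecewise_eq_of_mem _ _ _ hx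
  · refine hg.congr fun x hx => ?_
    by_cases h : x ∈ D
    · rw [Set.piecewise_eq_of_mem _ _ _ h, hfg x h hx]
    · rw [Set.piecewise_eq_of_notMem _ _ _ h]

/-- Maps from closed subsets of a low-dimensional space to a sphere extend. -/
lemma lowdim_ext {E F : Type*} [NormedAddCommGroup E] [NormedSpace ℝ E] [FiniteDimensional ℝ E]
    [NormedAddCommGroup F] [InnerProductSpace ℝ F] [FiniteDimensional ℝ F]
    (hdim : Module.finrank ℝ E < Module.finrank ℝ F) (A : Set E) (hA : IsClosed A)
    (f : E → F) (hf : ContinuousOn f A) (hn : ∀ x ∈ A, ‖f x‖ = 1) :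
    ∃ g : E → F, Continuous g ∧ (∀ x, ‖g x‖ = 1) ∧ ∀ x ∈ A, g x = f x := by
  -- extend f continuously
  have t1 := Metric.instTietzeExtensionClosedBall ℝ (0 : F) (r := 1) one_pos
  obtain ⟨f0, -, hf0⟩ := ContinuousMap.exists_forall_mem_restrict_eq hA
    (⟨A.domRestrict f, hf.domRestrict⟩ : C(A, F)) (t := Metric.closedBall (0 : F) 1)
    (fun x => by simp [hn x x.2])
  have hf0' : ∀ x ∈ A, f0 x = f x := fun x hx => congrArg (fun L => L ⟨x, hx⟩) hf0
  obtain ⟨g0, hg0, hg0d, -⟩ := f0.continuous.exists_contDiff_approx 1 (ε := fun _ => (1 / 8 : ℝ))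
    continuous_const (fun _ => by norm_num)
  have hg0' : ContDiff ℝ 1 g0 := hg0
  obtain ⟨p, hp, hp0⟩ := (hg0'.dense_compl_range_of_finrank_lt_finrank hdim).exists_dist_lt
    (0 : F) (ε := 1 / 8) (by norm_num)
  rw [dist_zero_left] at hp0
  have h1ne : ∀ x, g0 x - p ≠ 0 := fun x h => hp ⟨x, sub_eq_zero.1 h⟩
  set g2 : E → F := fun x => ‖g0 x - p‖⁻¹ • (g0 x - p) with hg2
  have hg2c : Continuous g2 := by
    have : Continuous (fun x => g0 x - p) := hg0'.continuous.sub continuous_const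
    exact (this.norm.inv₀ fun x => norm_ne_zero_iff.2 (h1ne x)).smul this
  have hg2n : ∀ x, ‖g2 x‖ = 1 := fun x => by
    rw [hg2]; simp only
    rw [norm_smul, norm_inv, norm_norm, inv_mul_cancel₀ (norm_ne_zero_iff.2 (h1ne x))]
  have hclose : ∀ x ∈ A, ‖f x - g2 x‖ ≤ 1 / 2 := by
    intro x hx
    have a1 : ‖f x - (g0 x - p)‖ ≤ 1 / 4 := by
      have h := hg0d x
      rw [dist_comm, dist_eq_norm, hf0' x hx] at h
      have : f x - (g0 x - p) = (f x - g0 x) + p := by abel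
      rw [this]
      refine (norm_add_le _ _).trans ?_
      linarith
    have a2 : ‖(g0 x - p) - g2 x‖ ≤ 1 / 4 := by
      set y := g0 x - p with hy
      have hyn : ‖y‖ ≠ 0 := norm_ne_zero_iff.2 (h1ne x)
      have e : y - g2 x = (‖y‖ - 1) • (‖y‖⁻¹ • y) := by
        rw [sub_smul, smul_smul, mul_inv_cancel₀ hyn, one_smul, one_smul]
      have e2 : ‖‖y‖⁻¹ • y‖ = 1 := hg2n x
      rw [e, norm_smul, e2, mul_one, Real.norm_eq_abs, abs_sub_comm]
      have := abs_norm_sub_norm_le (f x) y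
      rw [hn x hx] at this
      exact this.trans a1
    calc ‖f x - g2 x‖ = ‖(f x - (g0 x - p)) + ((g0 x - p) - g2 x)‖ := by congr 1; abel
      _ ≤ _ := norm_add_le _ _
      _ ≤ 1 / 2 := by linarith
  have t2 := Metric.instTietzeExtensionClosedBall ℝ (0 : F) (r := 1 / 2) (by norm_num)
  obtain ⟨u, hu, hu'⟩ := ContinuousMap.exists_forall_mem_restrict_eq hA
    (⟨A.domRestrict (fun x => f x - g2 x), (hf.sub hg2c.continuousOn).domRestrict⟩ : C(A, F))
    (t := Metric.closedBall (0 : F) (1 / 2))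
    (fun x => by simpa using hclose x x.2)
  have hu2 : ∀ x ∈ A, u x = f x - g2 x := fun x hx => congrArg (fun L => L ⟨x, hx⟩) hu'
  have hne : ∀ x, g2 x + u x ≠ 0 := by
    intro x h0
    have h1 := hu x
    rw [mem_closedBall_zero_iff] at h1
    have h2 : g2 x = - u x := eq_neg_of_add_eq_zero_left h0
    have h3 := hg2n x
    rw [h2, norm_neg] at h3
    linarith
  refine ⟨fun x => ‖g2 x + u x‖⁻¹ • (g2 x + u x), ?_, ?_, ?_⟩
  · have : Continuous (fun x => g2 x + u x) := hg2c.add u.continuous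
    exact (this.norm.inv₀ fun x => norm_ne_zero_iff.2 (hne x)).smul this
  · intro x
    rw [norm_smul, norm_inv, norm_norm, inv_mul_cancel₀ (norm_ne_zero_iff.2 (hne x))]
  · intro x hx
    simp only
    rw [hu2 x hx, add_sub_cancel, hn x hx, inv_one, one_smul]

section Cones

variable {V : Type*} [Fintype V]

/-- The cone over the clique complex of the graph `adj` restricted to `U`. -/
def gcone (adj : V → V → Prop) (U : Finset V) : Set (V → ℝ) :=
  {x | (∀ v, 0 ≤ x v) ∧ ∑ v, x v ≤ 1 ∧ (∀ v, v ∉ U → x v = 0) ∧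
    ∀ u w, u ≠ w → ¬ adj u w → x u = 0 ∨ x w = 0}

/-- Clique complexes on `W` which can be built up using expansions and small cells. -/
inductive Good (adj : V → V → Prop) : ℕ → Finset V → Prop
  | empty (m : ℕ) : Good adj m ∅
  | cone (m : ℕ) (W : Finset V) (v : V) (hv : v ∈ W) (h : ∀ w ∈ W, w ≠ v → adj v w) :
      Good adj m W
  | split (m : ℕ) (W : Finset V) (v : V) (hv : v ∈ W) (h1 : Good adj (m + 1) (W.erase v))
      (h2 : Good adj m (W.filter (fun w => w ≠ v ∧ adj v w))) : Good adj (m + 1) W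

lemma isClosed_gcone (adj : V → V → Prop) (U : Finset V) : IsClosed (gcone adj U) := by
  have e : gcone adj U = (⋂ v, {x | 0 ≤ x v}) ∩ ({x | ∑ v, x v ≤ 1} ∩
      ((⋂ v, ⋂ _ : v ∉ U, {x | x v = 0}) ∩
        ⋂ u, ⋂ w, ⋂ _ : u ≠ w, ⋂ _ : ¬ adj u w, ({x | x u = 0} ∪ {x | x w = 0}))) := by
    ext x; simp [gcone]
  rw [e]
  refine IsClosed.inter (isClosed_iInter fun v => isClosed_le (by fun_prop) (by fun_prop))
    (IsClosed.inter (isClosed_le (by fun_prop) (by fun_prop)) (IsClosed.inter ?_ ?_))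
  · exact isClosed_iInter fun v => isClosed_iInter fun _ =>
      isClosed_eq (by fun_prop) (by fun_prop)
  · exact isClosed_iInter fun u => isClosed_iInter fun w => isClosed_iInter fun _ =>
      isClosed_iInter fun _ => (isClosed_eq (by fun_prop) (by fun_prop)).union
        (isClosed_eq (by fun_prop) (by fun_prop))

lemma gcone_mono (adj : V → V → Prop) {U U' : Finset V} (h : U ⊆ U') :
    gcone adj U ⊆ gcone adj U' :=
  fun _ hx => ⟨hx.1, hx.2.1, fun v hv => hx.2.2.1 v (fun h' => hv (h h')), hx.2.2.2⟩

lemma continuous_fold_min (ρ : Finset V) :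
    Continuous (fun x : V → ℝ => ρ.fold min (1 - ∑ v, x v) x) := by
  induction ρ using Finset.induction_on with
  | empty => simp only [Finset.fold_empty]; fun_prop
  | insert a s ha ih =>
    simp only [Finset.fold_insert ha]
    exact (continuous_apply a).min ih

variable {F : Type*} [NormedAddCommGroup F] [InnerProductSpace ℝ F] [FiniteDimensional ℝ F]

/-- Adding a low-dimensional cell. -/
lemma ext_cell (adj : V → V → Prop) (ρ : Finset V) (hρ : ρ.card < Module.finrank ℝ F)
    (D : Set (V → ℝ)) (hD : IsClosed D) (f : (V → ℝ) → F) (hf : ContinuousOn f D)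
    (hn : ∀ x ∈ D, ‖f x‖ = 1) :
    ∃ g : (V → ℝ) → F, ContinuousOn g (D ∪ gcone adj ρ) ∧
      (∀ x ∈ D ∪ gcone adj ρ, ‖g x‖ = 1) ∧ ∀ x ∈ D, g x = f x := by
  let ι : (ρ → ℝ) → (V → ℝ) := fun y v => if h : v ∈ ρ then y ⟨v, h⟩ else 0
  have hι : Continuous ι := by
    refine continuous_pi fun v => ?_
    by_cases h : v ∈ ρ
    · simp only [ι, h, dif_pos]; exact continuous_apply _
    · simp only [ι, h, dif_neg, not_false_eq_true]; exact continuous_const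
  let r : (V → ℝ) → (ρ → ℝ) := fun x v => x v
  have hr : Continuous r := continuous_pi fun v => continuous_apply _
  have hιr : ∀ x ∈ gcone adj ρ, ι (r x) = x := by
    intro x hx
    funext v
    by_cases h : v ∈ ρ
    · simp [ι, r, h]
    · simp [ι, h, hx.2.2.1 v h]
  obtain ⟨G, hG, hGn, hGe⟩ := lowdim_ext (E := ρ → ℝ) (F := F) (by simpa using hρ) (ι ⁻¹' D)
    (hD.preimage hι) (f ∘ ι) (hf.comp hι.continuousOn (fun y hy => hy)) (fun y hy => hn _ hy)
  have hag : ∀ x ∈ D, x ∈ gcone adj ρ → f x = G (r x) := by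
    intro x hx hx'
    have : r x ∈ ι ⁻¹' D := by
      rw [Set.mem_preimage, hιr x hx']; exact hx
    rw [hGe _ this, Function.comp_apply, hιr x hx']
  refine ⟨D.piecewise f (fun x => G (r x)), glue_closed hD (isClosed_gcone adj ρ) hf
    (hG.comp hr).continuousOn hag, ?_, fun x hx => Set.piecewise_eq_of_mem _ _ _ hx⟩
  intro x _
  by_cases h : x ∈ D
  · rw [Set.piecewise_eq_of_mem _ _ _ h]; exact hn x h
  · rw [Set.piecewise_eq_of_notMem _ _ _ h]; exact hGn _

/-- Expanding along a cone. -/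
lemma ext_cone (adj : V → V → Prop) (hs : ∀ u w, adj u w → adj w u) (ρ W : Finset V)
    (hdis : Disjoint ρ W)
    (hadj : ∀ u ∈ ρ, ∀ w ∈ ρ ∪ W, u ≠ w → adj u w) (v : V) (hv : v ∈ W)
    (hc : ∀ w ∈ W, w ≠ v → adj v w)
    (D : Set (V → ℝ)) (hD : IsClosed D)
    (ha : ∀ x ∈ D, ∑ v, x v < 1 → ∃ u ∈ ρ, x u = 0)
    (hb : ∀ x ∈ gcone adj (ρ ∪ W), (∑ v, x v = 1 ∨ ∃ u ∈ ρ, x u = 0) → x ∈ D)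
    (f : (V → ℝ) → F) (hf : ContinuousOn f D)
    (hn : ∀ x ∈ D, ‖f x‖ = 1) :
    ∃ g : (V → ℝ) → F, ContinuousOn g (D ∪ gcone adj (ρ ∪ W)) ∧
      (∀ x ∈ D ∪ gcone adj (ρ ∪ W), ‖g x‖ = 1) ∧ ∀ x ∈ D, g x = f x := by
  have hvρ : v ∉ ρ := fun h => Finset.disjoint_left.1 hdis h hv
  let t : (V → ℝ) → ℝ := fun x => ρ.fold min (1 - ∑ v, x v) x
  have ht : Continuous t := continuous_fold_min ρ
  let r : (V → ℝ) → (V → ℝ) := fun x w =>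
    x w - (if w ∈ ρ then t x else 0) + (if w = v then t x * (ρ.card + 1) else 0)
  have hr : Continuous r := by
    refine continuous_pi fun w => ?_
    refine ((continuous_apply w).sub ?_).add ?_
    · split_ifs <;> fun_prop
    · split_ifs <;> fun_prop
  have ht0 : ∀ x ∈ gcone adj (ρ ∪ W), 0 ≤ t x := by
    intro x hx
    refine (Finset.le_fold_min _).2 ⟨by linarith [hx.2.1], fun u _ => hx.1 u⟩
  have ht1 : ∀ x, t x ≤ 1 - ∑ v, x v := fun x => ((Finset.le_fold_min _).1 (le_refl (t x))).1
  have ht2 : ∀ x, ∀ u ∈ ρ, t x ≤ x u := fun x => ((Finset.le_fold_min _).1 (le_refl (t x))).2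
  have hsum : ∀ x, ∑ w, r x w = ∑ w, x w + t x := by
    intro x
    simp only [r, Finset.sum_add_distrib, Finset.sum_sub_distrib]
    rw [Finset.sum_ite_eq' Finset.univ v]
    simp only [Finset.sum_ite_mem, Finset.univ_inter, Finset.sum_const, Finset.mem_univ, if_true,
      nsmul_eq_mul]
    ring
  have hsupp : ∀ x ∈ gcone adj (ρ ∪ W), ∀ w, w ≠ v → x w = 0 → r x w = 0 := by
    intro x hx w hw h0
    by_cases h : w ∈ ρ
    · have h1 := ht2 x w h
      rw [h0] at h1
      have : t x = 0 := le_antisymm h1 (ht0 x hx)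
      simp [r, h0, this]
    · simp [r, h0, h, hw]
  have hmem : ∀ x ∈ gcone adj (ρ ∪ W), r x ∈ gcone adj (ρ ∪ W) := by
    intro x hx
    refine ⟨fun w => ?_, ?_, fun w hw => ?_, fun u w huw hna => ?_⟩
    · have h1 := hx.1 w
      have h2 := ht0 x hx
      by_cases h : w ∈ ρ
      · have h3 := ht2 x w h
        have hwv : w ≠ v := fun e => hvρ (e ▸ h)
        simp only [r, h, hwv, if_true, if_false]; linarith
      · by_cases hwv : w = v
        · simp only [r, h, hwv, hvρ, if_true, if_false]
          have := hx.1 v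
          positivity
        · simp only [r, h, hwv, if_false]; linarith
    · rw [hsum]; linarith [ht1 x]
    · refine hsupp x hx w (fun e => hw ?_) (hx.2.2.1 w hw)
      rw [e]; exact Finset.mem_union_right _ hv
    · have key : ∀ w, w ≠ v → ¬ adj v w → x w = 0 := by
        intro w hwv hna
        by_contra h
        have hwU : w ∈ ρ ∪ W := by
          by_contra h'
          exact h (hx.2.2.1 w h')
        rcases Finset.mem_union.1 hwU with h' | h'
        · exact hna (hs _ _ (hadj w h' v (Finset.mem_union_right _ hv) hwv))
        · exact hna (hc w h' hwv)
      by_cases hu : u = v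
      · subst hu
        exact Or.inr (hsupp x hx w huw.symm (key w huw.symm hna))
      · by_cases hw : w = v
        · subst hw
          exact Or.inl (hsupp x hx u huw (key u huw (fun h => hna (hs _ _ h))))
        · exact (hx.2.2.2 u w huw hna).imp (hsupp x hx u hu) (hsupp x hx w hw)
  have hrD : ∀ x ∈ gcone adj (ρ ∪ W), r x ∈ D := by
    intro x hx
    refine hb _ (hmem x hx) ?_
    rcases (Finset.fold_min_le _).1 (le_refl (t x)) with h | ⟨u, hu, h⟩
    · left; rw [hsum]; linarith [ht1 x]
    · right
      refine ⟨u, hu, ?_⟩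
      have huv : u ≠ v := fun e => hvρ (e ▸ hu)
      simp only [r, hu, huv, if_true, if_false]
      linarith [ht2 x u hu]
  have hfix : ∀ x ∈ D, x ∈ gcone adj (ρ ∪ W) → r x = x := by
    intro x hx hx'
    have : t x = 0 := by
      refine le_antisymm ?_ (ht0 x hx')
      rcases lt_or_eq_of_le hx'.2.1 with h | h
      · obtain ⟨u, hu, h0⟩ := ha x hx h
        rw [← h0]; exact ht2 x u hu
      · have := ht1 x; linarith
    funext w
    simp [r, this]
  refine ⟨D.piecewise f (fun x => f (r x)), glue_closed hD (isClosed_gcone adj _) hf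
    (hf.comp hr.continuousOn hrD) (fun x hx hx' => by rw [hfix x hx hx']), ?_,
    fun x hx => Set.piecewise_eq_of_mem _ _ _ hx⟩
  intro x hx
  by_cases h : x ∈ D
  · rw [Set.piecewise_eq_of_mem _ _ _ h]; exact hn x h
  · rw [Set.piecewise_eq_of_notMem _ _ _ h]; exact hn _ (hrD x (hx.resolve_left h))

lemma good_ext (adj : V → V → Prop) (hs : ∀ u w, adj u w → adj w u) {m : ℕ} {W : Finset V}
    (hg : Good adj m W) : ∀ (ρ : Finset V) (D : Set (V → ℝ)), Disjoint ρ W →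
    (∀ u ∈ ρ, ∀ w ∈ ρ ∪ W, u ≠ w → adj u w) → ρ.card + m < Module.finrank ℝ F → IsClosed D →
    (∀ x ∈ D, ∑ v, x v < 1 → ∃ u ∈ ρ, x u = 0) →
    (∀ x ∈ gcone adj (ρ ∪ W), (∑ v, x v = 1 ∨ ∃ u ∈ ρ, x u = 0) → x ∈ D) →
    ∀ (f : (V → ℝ) → F), ContinuousOn f D → (∀ x ∈ D, ‖f x‖ = 1) →
    ∃ g : (V → ℝ) → F, ContinuousOn g (D ∪ gcone adj (ρ ∪ W)) ∧
      (∀ x ∈ D ∪ gcone adj (ρ ∪ W), ‖g x‖ = 1) ∧ ∀ x ∈ D, g x = f x := by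
  induction hg with
  | empty m =>
    intro ρ D _ _ hcard hD _ _ f hf hn
    rw [Finset.union_empty]
    exact ext_cell adj ρ (by omega) D hD f hf hn
  | cone m W v hv h =>
    intro ρ D hdis hadj hcard hD ha hb f hf hn
    exact ext_cone adj hs ρ W hdis hadj v hv h D hD ha hb f hf hn
  | split m W v hv h1 h2 ih1 ih2 =>
    intro ρ D hdis hadj hcard hD ha hb f hf hn
    have hvρ : v ∉ ρ := fun h => Finset.disjoint_left.1 hdis h hv
    have hsub1 : ρ ∪ W.erase v ⊆ ρ ∪ W := Finset.union_subset_union_right (Finset.erase_subset _ _)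
    obtain ⟨g1, hg1, hg1n, hg1e⟩ := ih1 ρ D (hdis.mono_right (Finset.erase_subset _ _))
      (fun u hu w hw => hadj u hu w (hsub1 hw)) hcard hD ha
      (fun x hx => hb x (gcone_mono adj hsub1 hx)) f hf hn
    set W' := W.filter (fun w => w ≠ v ∧ adj v w) with hW'
    have hsub2 : insert v ρ ∪ W' ⊆ ρ ∪ W := by
      intro w hw
      simp only [hW', Finset.mem_union, Finset.mem_insert, Finset.mem_filter] at hw ⊢
      rcases hw with (rfl | h) | h
      · exact Or.inr hv
      · exact Or.inl h
      · exact Or.inr h.1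
    obtain ⟨g2, hg2, hg2n, hg2e⟩ := ih2 (insert v ρ) (D ∪ gcone adj (ρ ∪ W.erase v))
      (by
        rw [Finset.disjoint_left]
        intro w hw hw'
        rw [hW', Finset.mem_filter] at hw'
        rcases Finset.mem_insert.1 hw with h | h
        · exact hw'.2.1 h
        · exact Finset.disjoint_left.1 hdis h hw'.1)
      (by
        intro u hu w hw huw
        rcases Finset.mem_insert.1 hu with h | h
        · subst h
          rcases Finset.mem_union.1 hw with h' | h'
          · rcases Finset.mem_insert.1 h' with h'' | h''
            · exact absurd h''.symm huw
            · exact hs _ _ (hadj w h'' u (Finset.mem_union_right _ hv) huw.symm)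
          · exact ((Finset.mem_filter.1 h').2).2
        · exact hadj u h w (hsub2 hw) huw)
      (by rw [Finset.card_insert_of_notMem hvρ]; omega)
      (hD.union (isClosed_gcone adj _))
      (by
        intro x hx hlt
        rcases hx with hx | hx
        · obtain ⟨u, hu, h0⟩ := ha x hx hlt
          exact ⟨u, Finset.mem_insert_of_mem hu, h0⟩
        · exact ⟨v, Finset.mem_insert_self _ _, hx.2.2.1 v (by simp [hvρ])⟩)
      (by
        intro x hx hor
        have hx' := gcone_mono adj hsub2 hx
        rcases hor with h | ⟨u, hu, h0⟩
        · exact Or.inl (hb x hx' (Or.inl h))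
        · rcases Finset.mem_insert.1 hu with h | h
          · subst h
            refine Or.inr ⟨hx.1, hx.2.1, fun w hw => ?_, hx.2.2.2⟩
            by_cases hwu : w = u
            · rw [hwu]; exact h0
            · refine hx'.2.2.1 w fun hw' => hw ?_
              rcases Finset.mem_union.1 hw' with h' | h'
              · exact Finset.mem_union_left _ h'
              · exact Finset.mem_union_right _ (Finset.mem_erase.2 ⟨hwu, h'⟩)
          · exact Or.inl (hb x hx' (Or.inr ⟨u, h, h0⟩)))
      g1 hg1 hg1n
    have hsubset : D ∪ gcone adj (ρ ∪ W) ⊆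
        (D ∪ gcone adj (ρ ∪ W.erase v)) ∪ gcone adj (insert v ρ ∪ W') := by
      rintro x (hx | hx)
      · exact Or.inl (Or.inl hx)
      · by_cases h0 : x v = 0
        · refine Or.inl (Or.inr ⟨hx.1, hx.2.1, fun w hw => ?_, hx.2.2.2⟩)
          by_cases hwu : w = v
          · rw [hwu]; exact h0
          · refine hx.2.2.1 w fun hw' => hw ?_
            rcases Finset.mem_union.1 hw' with h' | h'
            · exact Finset.mem_union_left _ h'
            · exact Finset.mem_union_right _ (Finset.mem_erase.2 ⟨hwu, h'⟩)
        · refine Or.inr ⟨hx.1, hx.2.1, fun w hw => ?_, hx.2.2.2⟩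
          by_contra hw0
          have hwU : w ∈ ρ ∪ W := by
            by_contra h'
            exact hw0 (hx.2.2.1 w h')
          have hwv : w ≠ v := fun e => hw (by simp [e])
          have hav : adj v w := by
            by_contra hna
            exact (hx.2.2.2 v w hwv.symm hna).elim h0 hw0
          apply hw
          rcases Finset.mem_union.1 hwU with h' | h'
          · exact Finset.mem_union_left _ (Finset.mem_insert_of_mem h')
          · exact Finset.mem_union_right _ (Finset.mem_filter.2 ⟨h', hwv, hav⟩)
    exact ⟨g2, hg2.mono hsubset, fun x hx => hg2n x (hsubset hx), fun x hx => by
      rw [hg2e x (Or.inl hx), hg1e x hx]⟩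

end Cones

section Count

variable {V : Type*} [Fintype V]

lemma good_of_card (adj : V → V → Prop) : ∀ (k : ℕ) (m : ℕ) (W : Finset V), W.card = k →
    W.card < 2 * m + 2 → Good adj m W := by
  intro k
  induction k using Nat.strong_induction_on with
  | _ k ih =>
    intro m W hk hW
    rcases W.eq_empty_or_nonempty with rfl | ⟨v, hv⟩
    · exact Good.empty m
    by_cases hc : ∀ w ∈ W, w ≠ v → adj v w
    · exact Good.cone m W v hv hc
    push Not at hc
    obtain ⟨w, hw, hwv, hna⟩ := hc
    have h2 : ((W.erase v).erase w).card = W.card - 2 := by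
      rw [Finset.card_erase_of_mem (Finset.mem_erase.2 ⟨hwv, hw⟩), Finset.card_erase_of_mem hv]
      omega
    have h3 : 2 ≤ W.card := Finset.one_lt_card.2 ⟨w, hw, v, hv, hwv⟩
    have h4 : (W.filter (fun w => w ≠ v ∧ adj v w)).card ≤ W.card - 2 := by
      rw [← h2]
      refine Finset.card_le_card fun u hu => ?_
      obtain ⟨h, h', h''⟩ := Finset.mem_filter.1 hu
      refine Finset.mem_erase.2 ⟨?_, Finset.mem_erase.2 ⟨h', h⟩⟩
      rintro rfl
      exact hna h''
    have h5 : (W.erase v).card = W.card - 1 := Finset.card_erase_of_mem hv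
    obtain ⟨m, rfl⟩ : ∃ m', m = m' + 1 := ⟨m - 1, by omega⟩
    exact Good.split m W v hv (ih _ (by omega) _ _ rfl (by omega))
      (ih _ (by omega) _ _ rfl (by omega))

lemma good_or_oct (adj : V → V → Prop) (m : ℕ) (W : Finset V) (hW : W.card ≤ 2 * m + 2)
    (hng : ¬ Good adj m W) : ∀ v ∈ W, ∃! w, w ∈ W ∧ w ≠ v ∧ ¬ adj v w := by
  intro v hv
  have hc : ¬ ∀ w ∈ W, w ≠ v → adj v w := fun hc => hng (Good.cone m W v hv hc)
  push Not at hc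
  obtain ⟨w, hw, hwv, hna⟩ := hc
  refine ⟨w, ⟨hw, hwv, hna⟩, ?_⟩
  rintro w' ⟨hw', hwv', hna'⟩
  by_contra hne
  have h1 : (W.filter (fun w => w ≠ v ∧ adj v w)) ⊆ ((W.erase v).erase w).erase w' := by
    intro u hu
    obtain ⟨h, h', h''⟩ := Finset.mem_filter.1 hu
    refine Finset.mem_erase.2 ⟨?_, Finset.mem_erase.2 ⟨?_, Finset.mem_erase.2 ⟨h', h⟩⟩⟩
    · rintro rfl
      exact hna' h''
    · rintro rfl
      exact hna h''
  have m1 : w ∈ W.erase v := Finset.mem_erase.2 ⟨hwv, hw⟩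
  have m2 : w' ∈ (W.erase v).erase w := Finset.mem_erase.2 ⟨hne, Finset.mem_erase.2 ⟨hwv', hw'⟩⟩
  have c1 := Finset.card_erase_add_one hv
  have c2 := Finset.card_erase_add_one m1
  have c3 := Finset.card_erase_add_one m2
  have c4 := Finset.card_le_card h1
  obtain ⟨m, rfl⟩ : ∃ m', m = m' + 1 := ⟨m - 1, by omega⟩
  exact hng (Good.split m W v hv (good_of_card adj _ _ _ rfl (by omega))
    (good_of_card adj _ _ _ rfl (by omega)))

/-- The geometric realization of the clique complex of the graph `adj`. -/
def gbase (adj : V → V → Prop) : Set (V → ℝ) :=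
  {x | x ∈ gcone adj Finset.univ ∧ ∑ v, x v = 1}

lemma isClosed_gbase (adj : V → V → Prop) : IsClosed (gbase adj) :=
  (isClosed_gcone adj _).inter (isClosed_eq (by fun_prop) (by fun_prop))

lemma gbase_norm_le (adj : V → V → Prop) {x : V → ℝ} (hx : x ∈ gbase adj) : ‖x‖ ≤ 1 := by
  refine (pi_norm_le_iff_of_nonneg zero_le_one).2 fun v => ?_
  rw [Real.norm_of_nonneg (hx.1.1 v), ← hx.2]
  exact Finset.single_le_sum (fun u _ => hx.1.1 u) (Finset.mem_univ v)

lemma isCompact_gbase (adj : V → V → Prop) : IsCompact (gbase adj) := by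
  refine (isCompact_closedBall (0 : V → ℝ) 1).of_isClosed_subset (isClosed_gbase adj) ?_
  intro x hx
  simpa using gbase_norm_le adj hx

variable {F : Type*} [NormedAddCommGroup F] [InnerProductSpace ℝ F] [FiniteDimensional ℝ F]

lemma good_false (adj : V → V → Prop) (hs : ∀ u w, adj u w → adj w u) {m : ℕ}
    (hg : Good adj m Finset.univ) (hdim : m < Module.finrank ℝ F)
    (f : (V → ℝ) → F) (hf : ContinuousOn f (gbase adj)) (hn : ∀ x ∈ gbase adj, ‖f x‖ = 1)
    (h : F → (V → ℝ)) (hh : ContinuousOn h (Metric.sphere 0 1))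
    (hm : ∀ y, ‖y‖ = 1 → h y ∈ gbase adj) (hfh : ∀ y, ‖y‖ = 1 → f (h y) = y) : False := by
  obtain ⟨g, hgc, hgn, hge⟩ := good_ext (F := F) adj hs hg ∅ (gbase adj) (by simp) (by simp)
    (by simpa using hdim) (isClosed_gbase adj) (fun x hx hlt => absurd hx.2 hlt.ne)
    (by
      intro x hx hor
      rw [Finset.empty_union] at hx
      rcases hor with h | ⟨u, hu, _⟩
      · exact ⟨hx, h⟩
      · simp at hu) f hf hn
  rw [Finset.empty_union] at hgc hgn
  let q : F → (V → ℝ) := fun y => ‖y‖ • h (‖y‖⁻¹ • y)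
  have hunit : ∀ y : F, y ≠ 0 → ‖‖y‖⁻¹ • y‖ = 1 := fun y hy => by
    rw [norm_smul, norm_inv, norm_norm, inv_mul_cancel₀ (norm_ne_zero_iff.2 hy)]
  have hqb : ∀ y, ‖q y‖ ≤ ‖y‖ := by
    intro y
    by_cases hy : y = 0
    · simp [q, hy]
    · simp only [q]
      rw [norm_smul, norm_norm]
      exact mul_le_of_le_one_right (norm_nonneg _) (gbase_norm_le adj (hm _ (hunit y hy)))
  have hqc : Continuous q := by
    rw [continuous_iff_continuousAt]
    intro y
    by_cases hy : y = 0
    · subst hy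
      have : q 0 = 0 := by simp [q]
      rw [ContinuousAt, this]
      refine squeeze_zero_norm hqb ?_
      have := (continuous_norm (E := F)).tendsto 0
      simpa using this
    · have hop : IsOpen ({0}ᶜ : Set F) := isOpen_compl_singleton
      have : ContinuousOn q ({0}ᶜ : Set F) := by
        refine continuous_norm.continuousOn.smul (hh.comp ?_ ?_)
        · exact (continuous_norm.continuousOn.inv₀ fun z hz => norm_ne_zero_iff.2 hz).smul
            continuousOn_id
        · intro z hz
          simpa using hunit z hz
      exact this.continuousAt (hop.mem_nhds hy)
  have hqm : ∀ y, ‖y‖ ≤ 1 → q y ∈ gcone adj Finset.univ := by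
    intro y hy1
    by_cases hy : y = 0
    · have : q y = 0 := by simp [q, hy]
      rw [this]
      refine ⟨fun v => le_rfl, by simp, fun v _ => rfl, fun u w _ _ => Or.inl rfl⟩
    · have hb := hm _ (hunit y hy)
      refine ⟨fun v => mul_nonneg (norm_nonneg _) (hb.1.1 v), ?_, fun v hv => by simp at hv, ?_⟩
      · have : ∑ v, q y v = ‖y‖ * ∑ v, h (‖y‖⁻¹ • y) v := by
          rw [Finset.mul_sum]; rfl
        rw [this, hb.2, mul_one]; exact hy1
      · intro u w huw hna
        refine (hb.1.2.2.2 u w huw hna).imp (fun e => ?_) (fun e => ?_) <;>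
          simp [q, e]
  refine no_retraction (fun y => g (q y)) (hgc.comp hqc.continuousOn ?_) ?_ ?_
  · intro y hy
    exact Or.inr (hqm y (by simpa using hy))
  · intro y hy
    exact hgn _ (Or.inr (hqm y hy))
  · intro y hy
    have : q y = h y := by simp [q, hy]
    simp only [this]
    rw [hge _ (hm y hy), hfh y hy]

end Count

/-- A fixed-point free involution on a set with `2n+2` elements is standard. -/
lemma involution_equiv {V : Type*} [Fintype V] (n : ℕ) (hcard : Fintype.card V = 2 * n + 2)
    (i : V → V) (hi : ∀ v, i (i v) = v) (hne : ∀ v, i v ≠ v) :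
    ∃ e : V ≃ Fin (n + 1) × Bool, ∀ v, e (i v) = ((e v).1, !(e v).2) := by
  let e0 := Fintype.equivFin V
  let A := {v : V // e0 v < e0 (i v)}
  have hlt : ∀ v, ¬ e0 v < e0 (i v) → e0 (i v) < e0 (i (i v)) := by
    intro v hv
    rw [hi]
    exact lt_of_le_of_ne (not_lt.1 hv) fun h => hne v (e0.injective h)
  let E1 : V ≃ A × Bool :=
    { toFun := fun v => if h : e0 v < e0 (i v) then (⟨v, h⟩, true) else (⟨i v, hlt v h⟩, false)
      invFun := fun p => if p.2 then p.1.1 else i p.1.1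
      left_inv := by
        intro v
        by_cases h : e0 v < e0 (i v)
        · simp [h]
        · simp [h, hi]
      right_inv := by
        rintro ⟨⟨v, hv⟩, b⟩
        cases b
        · have : ¬ e0 (i v) < e0 v := hv.asymm
          simp [this, hi]
        · simp [hv] }
  have hE1 : ∀ v, E1 (i v) = ((E1 v).1, !(E1 v).2) := by
    intro v
    by_cases h : e0 v < e0 (i v)
    · have h' : ¬ e0 (i v) < e0 v := h.asymm
      simp [E1, h, h', hi]
    · have h' := hlt v h
      simp [E1, h, h']
  have hA : Fintype.card A = n + 1 := by
    have := Fintype.card_congr E1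
    rw [Fintype.card_prod, Fintype.card_bool] at this
    omega
  let E2 : A ≃ Fin (n + 1) := Fintype.equivFinOfCardEq hA
  refine ⟨E1.trans (E2.prodCongr (Equiv.refl Bool)), fun v => ?_⟩
  simp [hE1]

lemma mem_hull_image {V E : Type*} [Fintype V] [AddCommGroup E] [Module ℝ E]
    (ι : V → E) (hι : Function.Injective ι) (τ : Finset V) (p : E) :
    p ∈ convexHull ℝ ((τ.image ι : Finset E) : Set E) ↔
      ∃ x : V → ℝ, (∀ v, 0 ≤ x v) ∧ ∑ v, x v = 1 ∧ (∀ v, v ∉ τ → x v = 0) ∧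
        ∑ v, x v • ι v = p := by
  have key : ∀ x : V → ℝ, (∀ v, v ∉ τ → x v = 0) →
      (∑ v ∈ τ, x v = ∑ v, x v) ∧ (∑ v ∈ τ, x v • ι v = ∑ v, x v • ι v) := by
    intro x hx
    refine ⟨Finset.sum_subset (Finset.subset_univ _) fun v _ hv => hx v hv,
      Finset.sum_subset (Finset.subset_univ _) fun v _ hv => by simp [hx v hv]⟩
  rw [Finset.mem_convexHull]
  constructor
  · rintro ⟨w, hw0, hw1, hw⟩
    rw [Finset.centerMass_eq_of_sum_1 _ _ hw1] at hw
    rw [Finset.sum_image (fun a _ b _ h => hι h)] at hw hw1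
    let x : V → ℝ := fun v => if v ∈ τ then w (ι v) else 0
    have hx : ∀ v, v ∉ τ → x v = 0 := fun v hv => by simp [x, hv]
    refine ⟨x, fun v => ?_, ?_, hx, ?_⟩
    · by_cases h : v ∈ τ
      · simp only [x, h, if_true]; exact hw0 _ (Finset.mem_image_of_mem _ h)
      · simp [x, h]
    · rw [← (key x hx).1, ← hw1]
      exact Finset.sum_congr rfl fun v hv => by simp [x, hv]
    · rw [← (key x hx).2, ← hw]
      exact Finset.sum_congr rfl fun v hv => by simp [x, hv]
  · rintro ⟨x, hx0, hx1, hx, hp⟩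
    have hinv : ∀ v, Function.extend ι x 0 (ι v) = x v := fun v => hι.extend_apply x 0 v
    have h1 : ∑ y ∈ τ.image ι, Function.extend ι x 0 y = 1 := by
      rw [Finset.sum_image (fun a _ b _ h => hι h)]
      simp only [hinv]
      rw [(key x hx).1, hx1]
    refine ⟨Function.extend ι x 0, ?_, h1, ?_⟩
    · intro y hy
      obtain ⟨v, _, rfl⟩ := Finset.mem_image.1 hy
      rw [hinv]; exact hx0 v
    · rw [Finset.centerMass_eq_of_sum_1 _ _ h1, Finset.sum_image (fun a _ b _ h => hι h)]
      simp only [hinv, id]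
      rw [(key x hx).2, hp]

lemma indep_coords {V E : Type*} [Fintype V] [AddCommGroup E] [Module ℝ E]
    (ι : V → E) (hι : Function.Injective ι) (τ : Finset V)
    (hind : AffineIndependent ℝ ((↑) : ↥(τ.image ι) → E)) (x y : V → ℝ)
    (hx : ∀ v, v ∉ τ → x v = 0) (hy : ∀ v, v ∉ τ → y v = 0)
    (h1 : ∑ v, x v = ∑ v, y v) (h2 : ∑ v, x v • ι v = ∑ v, y v • ι v) : x = y := by
  let f : τ ↪ ↥(τ.image ι) :=
    ⟨fun v => ⟨ι v, Finset.mem_image_of_mem _ v.2⟩, fun a b h => by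
      simp only [Subtype.mk.injEq] at h
      exact Subtype.ext (hι h)⟩
  have h := hind.comp_embedding f
  rw [affineIndependent_iff] at h
  have hz : ∀ v, v ∉ τ → x v - y v = 0 := fun v hv => by rw [hx v hv, hy v hv, sub_zero]
  have a1 : ∑ v : τ, (x v - y v) = 0 := by
    rw [Finset.sum_coe_sort τ (fun v => x v - y v),
      Finset.sum_subset (Finset.subset_univ _) fun v _ hv => hz v hv, Finset.sum_sub_distrib, h1,
      sub_self]
  have a2 : ∑ v : τ, (x v - y v) • ι v = 0 := by
    rw [Finset.sum_coe_sort τ (fun v => (x v - y v) • ι v),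
      Finset.sum_subset (Finset.subset_univ _) fun v _ hv => by rw [hz v hv, zero_smul]]
    simp only [sub_smul]
    rw [Finset.sum_sub_distrib, h2, sub_self]
  have := h Finset.univ (fun v => x v - y v) a1 a2
  funext v
  by_cases hv : v ∈ τ
  · exact sub_eq_zero.1 (this ⟨v, hv⟩ (Finset.mem_univ _))
  · rw [hx v hv, hy v hv]

lemma space_homeo {V E : Type*} [Fintype V] [NormedAddCommGroup E] [NormedSpace ℝ E] (adj : V → V → Prop)
    (K : Geometry.SimplicialComplex ℝ (E))
    (ι : V → E) (hι : Function.Injective ι)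
    (hK : ∀ σ : Finset (E), σ ∈ K.faces ↔ σ.Nonempty ∧
      ∃ τ : Finset V, σ = τ.image ι ∧ ∀ u ∈ τ, ∀ w ∈ τ, u ≠ w → adj u w) :
    Nonempty (gbase adj ≃ₜ K.space) := by
  have hsupp : ∀ x ∈ gbase adj,
      (Finset.univ.filter (fun v => x v ≠ 0)).image ι ∈ K.faces := by
    intro x hx
    rw [hK]
    constructor
    · rw [Finset.image_nonempty]
      by_contra hne
      rw [Finset.not_nonempty_iff_eq_empty, Finset.filter_eq_empty_iff] at hne
      have : ∑ v, x v = 0 := Finset.sum_eq_zero fun v hv => not_not.1 (hne hv)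
      have h1 : ∑ v, x v = 1 := hx.2
      linarith
    · refine ⟨_, rfl, fun u hu w hw huw => ?_⟩
      by_contra hadj
      simp only [Finset.mem_filter, Finset.mem_univ, true_and] at hu hw
      rcases hx.1.2.2.2 u w huw hadj with h | h
      · exact hu h
      · exact hw h
  have hmem : ∀ x ∈ gbase adj, ∑ v, x v • ι v ∈
      convexHull ℝ (((Finset.univ.filter (fun v => x v ≠ 0)).image ι : Finset E) : Set E) := by
    intro x hx
    rw [mem_hull_image ι hι]
    refine ⟨x, hx.1.1, hx.2, fun v hv => ?_, rfl⟩
    simpa using hv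
  let Φ : gbase adj → K.space := fun x => ⟨∑ v, x.1 v • ι v,
    Geometry.SimplicialComplex.mem_space_iff.2 ⟨_, hsupp x.1 x.2, hmem x.1 x.2⟩⟩
  have hcont : Continuous Φ := by
    refine Continuous.subtype_mk ?_ _
    exact continuous_finsetSum _ fun v _ =>
      ((continuous_apply v).comp continuous_subtype_val).smul continuous_const
  have hinj : Function.Injective Φ := by
    rintro ⟨x, hx⟩ ⟨y, hy⟩ hxy
    have hxy : ∑ v, x v • ι v = ∑ v, y v • ι v := congrArg Subtype.val hxy
    have h := K.inter_subset_convexHull (hsupp x hx) (hsupp y hy)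
      ⟨hmem x hx, hxy ▸ hmem y hy⟩
    rw [← Finset.coe_inter, ← Finset.image_inter _ _ hι, mem_hull_image ι hι] at h
    obtain ⟨z, _, hz1, hz, hzp⟩ := h
    have ex : x = z := by
      refine indep_coords ι hι _ (K.indep (hsupp x hx)) x z (fun v hv => by simpa using hv)
        (fun v hv => hz v fun h => hv (Finset.mem_inter.1 h).1) ?_ hzp.symm
      rw [hz1]; exact hx.2
    have ey : y = z := by
      refine indep_coords ι hι _ (K.indep (hsupp y hy)) y z (fun v hv => by simpa using hv)
        (fun v hv => hz v fun h => hv (Finset.mem_inter.1 h).2) ?_ (hxy.symm.trans hzp.symm)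
      rw [hz1]; exact hy.2
    exact Subtype.ext (ex.trans ey.symm)
  have hsurj : Function.Surjective Φ := by
    rintro ⟨p, hp⟩
    obtain ⟨s, hs, hps⟩ := Geometry.SimplicialComplex.mem_space_iff.1 hp
    obtain ⟨_, τ, rfl, hτ⟩ := (hK s).1 hs
    obtain ⟨x, hx0, hx1, hx, hxp⟩ := (mem_hull_image ι hι τ p).1 hps
    refine ⟨⟨x, ⟨hx0, hx1.le, fun v hv => absurd (Finset.mem_univ v) hv, fun u w huw ha => ?_⟩, hx1⟩,
      Subtype.ext hxp⟩
    by_contra hcon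
    push Not at hcon
    exact ha (hτ u (by_contra fun h => hcon.1 (hx u h)) w (by_contra fun h => hcon.2 (hx w h)) huw)
  haveI : CompactSpace (gbase adj) := isCompact_iff_compactSpace.1 (isCompact_gbase adj)
  exact ⟨Continuous.homeoOfEquivCompactToT2 (f := Equiv.ofBijective Φ ⟨hinj, hsurj⟩) hcont⟩

lemma not_good_of_homeo {V : Type*} [Fintype V] (n : ℕ) (adj : V → V → Prop)
    (hs : ∀ u w, adj u w → adj w u)
    (H : Nonempty (gbase adj ≃ₜ Metric.sphere (0 : EuclideanSpace ℝ (Fin (n + 1))) 1)) :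
    ¬ Good adj n Finset.univ := by
  intro hg
  obtain ⟨H⟩ := H
  refine good_false (F := EuclideanSpace ℝ (Fin (n + 1))) adj hs hg (by simp)
    (fun x => if hx : x ∈ gbase adj then (H ⟨x, hx⟩ : EuclideanSpace ℝ (Fin (n + 1))) else 0)
    ?_ ?_
    (fun y => if hy : y ∈ Metric.sphere (0 : EuclideanSpace ℝ (Fin (n + 1))) 1 then
      (H.symm ⟨y, hy⟩ : V → ℝ) else 0) ?_ ?_ ?_
  · rw [continuousOn_iff_continuous_domRestrict]
    have : (gbase adj).domRestrict (fun x => if hx : x ∈ gbase adj then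
        (H ⟨x, hx⟩ : EuclideanSpace ℝ (Fin (n + 1))) else 0) = fun x => (H x).1 := by
      funext x
      simp [Set.domRestrict]
    rw [this]
    exact continuous_subtype_val.comp H.continuous
  · intro x hx
    simp only [hx, dif_pos]
    simpa using (H ⟨x, hx⟩).2
  · rw [continuousOn_iff_continuous_domRestrict]
    have : (Metric.sphere (0 : EuclideanSpace ℝ (Fin (n + 1))) 1).domRestrict
        (fun y => if hy : y ∈ Metric.sphere (0 : EuclideanSpace ℝ (Fin (n + 1))) 1 then
        (H.symm ⟨y, hy⟩ : V → ℝ) else 0) = fun y => (H.symm y).1 := by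
      funext y
      exact dif_pos y.2
    rw [this]
    exact continuous_subtype_val.comp H.symm.continuous
  · intro y hy
    have hy : y ∈ Metric.sphere (0 : EuclideanSpace ℝ (Fin (n + 1))) 1 := by simpa using hy
    simp only [hy, dif_pos]
    exact (H.symm ⟨y, hy⟩).2
  · intro y hy
    have hy : y ∈ Metric.sphere (0 : EuclideanSpace ℝ (Fin (n + 1))) 1 := by simpa using hy
    simp only [hy, dif_pos]
    have h2 := (H.symm ⟨y, hy⟩).2
    simp only [h2, dif_pos, Subtype.coe_eta, Homeomorph.apply_symm_apply]

lemma fZero_eq_card {V X : Type*} [Fintype V] (F : Set (Finset X)) (g : V → X)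
    (hg : Function.Injective g) (h : ∀ x, ({x} : Finset X) ∈ F ↔ ∃ v, g v = x) :
    fZero F = Fintype.card V := by
  have e : {σ ∈ F | σ.card = 1} = (fun v => ({g v} : Finset X)) '' Set.univ := by
    ext σ
    simp only [Set.mem_setOf_eq, Set.image_univ, Set.mem_range, Finset.card_eq_one]
    constructor
    · rintro ⟨hσ, x, rfl⟩
      obtain ⟨v, rfl⟩ := (h x).1 hσ
      exact ⟨v, rfl⟩
    · rintro ⟨v, rfl⟩
      exact ⟨(h _).2 ⟨v, rfl⟩, _, rfl⟩
  rw [fZero, e, Set.ncard_image_of_injective _ (fun a b hab => hg (Finset.singleton_injective hab)),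
    Set.ncard_univ, Nat.card_eq_fintype_card]

lemma flag_main {E : Type*} [NormedAddCommGroup E] [NormedSpace ℝ E] (n : ℕ)
    (K : Geometry.SimplicialComplex ℝ E) (A : Set (Finset E)) (hAK : A = insert ∅ K.faces)
    (hfin : K.faces.Finite)
    (H : K.space ≃ₜ Metric.sphere (0 : EuclideanSpace ℝ (Fin (n + 1))) 1) (hF : IsFlag A) :
    2 * n + 2 ≤ fZero A ∧ (fZero A = 2 * n + 2 → CombIso A (octFaces n)) := by
  have hdown : ∀ σ ∈ A, ∀ τ, τ ⊆ σ → τ ∈ A := by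
    intro σ hσ τ hτ
    rcases τ.eq_empty_or_nonempty with rfl | hne
    · exact hAK ▸ Set.mem_insert _ _
    · rw [hAK] at hσ
      rcases hσ with rfl | hσ
      · exact absurd (Finset.subset_empty.1 hτ) hne.ne_empty
      · exact hAK ▸ Set.mem_insert_of_mem _ (K.down_closed hσ hτ hne)
  have hsub : ∀ σ ∈ A, σ.Nonempty → σ ∈ K.faces := by
    intro σ hσ hne
    rw [hAK] at hσ
    rcases hσ with h | h
    · exact absurd h hne.ne_empty
    · exact h
  have hfinA : A.Finite := hAK ▸ hfin.insert _
  let V := {x : E // ({x} : Finset E) ∈ A}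
  have : Finite V := by
    have : Finite A := hfinA
    exact Finite.of_injective (fun v : V => (⟨{v.1}, v.2⟩ : A)) fun a b h =>
      Subtype.ext (Finset.singleton_injective (congrArg Subtype.val h))
  have := Fintype.ofFinite V
  have hcard : fZero A = Fintype.card V :=
    fZero_eq_card _ (Subtype.val : V → _) Subtype.val_injective fun x =>
      ⟨fun h => ⟨⟨x, h⟩, rfl⟩, by rintro ⟨v, rfl⟩; exact v.2⟩
  let adj : V → V → Prop := fun u w => ({u.1, w.1} : Finset E) ∈ A
  have hs : ∀ u w, adj u w → adj w u := by
    intro u w h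
    simp only [adj] at h ⊢
    rwa [Finset.pair_comm]
  have hcl : ∀ τ : Finset V, τ.image Subtype.val ∈ A ↔
      ∀ u ∈ τ, ∀ w ∈ τ, u ≠ w → adj u w := by
    intro τ
    constructor
    · intro h u hu w hw _
      refine hdown _ h _ ?_
      intro x hx
      rcases Finset.mem_insert.1 hx with rfl | hx
      · exact Finset.mem_image_of_mem _ hu
      · rw [Finset.mem_singleton.1 hx]; exact Finset.mem_image_of_mem _ hw
    · intro h
      refine hF _ ?_ ?_
      · intro u hu
        obtain ⟨v, _, rfl⟩ := Finset.mem_image.1 hu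
        exact v.2
      · intro u hu w hw huw
        obtain ⟨u, hu1, rfl⟩ := Finset.mem_image.1 hu
        obtain ⟨w, hw1, rfl⟩ := Finset.mem_image.1 hw
        exact h u hu1 w hw1 fun h => huw (congrArg _ h)
  have hK : ∀ σ : Finset E, σ ∈ K.faces ↔ σ.Nonempty ∧
      ∃ τ : Finset V, σ = τ.image Subtype.val ∧ ∀ u ∈ τ, ∀ w ∈ τ, u ≠ w → adj u w := by
    intro σ
    constructor
    · intro hσ
      have hσ' : σ ∈ A := hAK ▸ Set.mem_insert_of_mem _ hσ
      refine ⟨K.nonempty_of_mem_faces hσ, ?_⟩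
      have e : σ = (Finset.univ.filter (fun v : V => v.1 ∈ σ)).image Subtype.val := by
        ext x
        simp only [Finset.mem_image, Finset.mem_filter, Finset.mem_univ, true_and]
        constructor
        · intro hx
          exact ⟨⟨x, hdown σ hσ' _ (Finset.singleton_subset_iff.2 hx)⟩, hx, rfl⟩
        · rintro ⟨v, hv, rfl⟩
          exact hv
      exact ⟨_, e, (hcl _).1 (e ▸ hσ')⟩
    · rintro ⟨hne, τ, rfl, hτ⟩
      exact hsub _ ((hcl τ).2 hτ) hne
  obtain ⟨H'⟩ := space_homeo adj K Subtype.val Subtype.val_injective hK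
  have hng := not_good_of_homeo n adj hs ⟨H'.trans H⟩
  rw [hcard]
  constructor
  · by_contra hlt
    exact hng (good_of_card adj _ n Finset.univ rfl (by rw [Finset.card_univ]; omega))
  · intro hc
    have hu := good_or_oct adj n Finset.univ (by rw [Finset.card_univ]; omega) hng
    choose i hi hiu using fun v => hu v (Finset.mem_univ v)
    have hi1 : ∀ v, i v ≠ v := fun v => (hi v).2.1
    have hi2 : ∀ v, ¬ adj v (i v) := fun v => (hi v).2.2
    have huq : ∀ v w, w ≠ v → ¬ adj v w → w = i v := fun v w h1 h2 =>
      hiu v w ⟨Finset.mem_univ _, h1, h2⟩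
    obtain ⟨e, he⟩ := involution_equiv n hc i
      (fun v => (huq (i v) v (hi1 v).symm fun h => hi2 v (hs _ _ h)).symm) hi1
    have hoct : ∀ y : Fin (n + 1) × Bool, ({y} : Finset (Fin (n + 1) × Bool)) ∈ octFaces n := by
      intro y j h
      have h1 := Finset.mem_singleton.1 h.1
      have h2 := Finset.mem_singleton.1 h.2
      have := congrArg Prod.snd (h1.trans h2.symm)
      simp at this
    refine ⟨e.trans (Equiv.subtypeUnivEquiv hoct).symm, fun σ => ?_⟩
    rw [hcl]
    simp only [octFaces, Set.mem_setOf_eq, Finset.mem_image]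
    constructor
    · rintro h j ⟨⟨u, hu, hu'⟩, ⟨w, hw, hw'⟩⟩
      have hu' : e u = (j, true) := hu'
      have hw' : e w = (j, false) := hw'
      have hwu : w = i u := e.injective (by rw [he, hu', hw']; rfl)
      subst hwu
      exact hi2 u (h u hu _ hw (hi1 u).symm)
    · intro h u hu w hw huw
      by_contra hadj
      have hwu := huq u w huw.symm hadj
      have hew := he u
      rw [← hwu] at hew
      rcases hb : e u with ⟨j, b⟩
      rw [hb] at hew
      cases b
      · exact h j ⟨⟨w, hw, hew⟩, ⟨u, hu, hb⟩⟩
      · exact h j ⟨⟨u, hu, hb⟩, ⟨w, hw, hew⟩⟩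

/-- Adjacency in the octahedral graph. -/
def octAdj (n : ℕ) (u w : Fin (n + 1) × Bool) : Prop := w ≠ (u.1, !u.2)

lemma oct_clique (n : ℕ) (τ : Finset (Fin (n + 1) × Bool)) :
    τ ∈ octFaces n ↔ ∀ u ∈ τ, ∀ w ∈ τ, u ≠ w → octAdj n u w := by
  constructor
  · rintro h ⟨j, b⟩ hu w hw _ rfl
    cases b
    · exact h j ⟨hw, hu⟩
    · exact h j ⟨hu, hw⟩
  · rintro h j ⟨h1, h2⟩
    exact h _ h1 _ h2 (by simp) (by simp)

lemma oct_homeo (n : ℕ) :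
    Nonempty (gbase (octAdj n) ≃ₜ Metric.sphere (0 : EuclideanSpace ℝ (Fin (n + 1))) 1) := by
  let S : EuclideanSpace ℝ (Fin (n + 1)) → ℝ := fun y => ∑ j, |y j|
  have hScont : Continuous S := by fun_prop
  have hSpos : ∀ y, y ≠ 0 → 0 < S y := by
    intro y hy
    refine lt_of_le_of_ne (Finset.sum_nonneg fun _ _ => abs_nonneg _) fun h => hy ?_
    have := (Finset.sum_eq_zero_iff_of_nonneg fun j _ => abs_nonneg (y j)).1 h.symm
    ext j
    simpa using this j (Finset.mem_univ j)
  let sg : Bool → ℝ := fun b => if b then 1 else -1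
  let g : EuclideanSpace ℝ (Fin (n + 1)) → (Fin (n + 1) × Bool → ℝ) :=
    fun y p => max (sg p.2 * y p.1) 0 / S y
  have hdiff : ∀ y j, g y (j, true) - g y (j, false) = y j / S y := by
    intro y j
    simp only [g, sg, ← sub_div]
    congr 1
    simp
  have hsum : ∀ y j, g y (j, true) + g y (j, false) = |y j| / S y := by
    intro y j
    simp only [g, sg, ← add_div]
    congr 1
    simp
  have hne : ∀ y : Metric.sphere (0 : EuclideanSpace ℝ (Fin (n + 1))) 1, y.1 ≠ 0 := by
    intro y h
    have := y.2
    simp [h] at this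
  have hg : ∀ y, y ≠ 0 → g y ∈ gbase (octAdj n) := by
    intro y hy
    have h1 : ∑ p, g y p = 1 := by
      rw [Fintype.sum_prod_type]
      simp only [Fintype.sum_bool, hsum]
      rw [← Finset.sum_div]
      exact div_self (hSpos y hy).ne'
    refine ⟨⟨fun p => div_nonneg (le_max_right _ _) (hSpos y hy).le, h1.le,
      fun v hv => absurd (Finset.mem_univ v) hv, ?_⟩, h1⟩
    rintro ⟨j, b⟩ w _ hadj
    have hw : w = (j, !b) := not_not.1 hadj
    subst hw
    simp only [g, sg]
    rcases le_total 0 (y j) with h | h <;> cases b <;> simp [h]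
  let G : Metric.sphere (0 : EuclideanSpace ℝ (Fin (n + 1))) 1 → gbase (octAdj n) :=
    fun y => ⟨g y.1, hg _ (hne y)⟩
  have hG : Continuous G := by
    refine Continuous.subtype_mk (continuous_pi fun p => ?_) _
    refine Continuous.div ?_ (hScont.comp continuous_subtype_val) fun y => (hSpos _ (hne y)).ne'
    fun_prop
  have hinj : Function.Injective G := by
    intro y z hyz
    have hyz : g y.1 = g z.1 := congrArg Subtype.val hyz
    have hSy := hSpos _ (hne y)
    have hSz := hSpos _ (hne z)
    have h : y.1 = (S y.1 / S z.1) • z.1 := by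
      ext j
      have := hdiff y.1 j
      rw [hyz, hdiff z.1 j] at this
      simp only [PiLp.smul_apply, smul_eq_mul]
      field_simp at this ⊢
      linarith
    have hny : ‖y.1‖ = 1 := by simpa using y.2
    have hnz : ‖z.1‖ = 1 := by simpa using z.2
    have hn := congrArg norm h
    rw [norm_smul, hny, hnz, mul_one, Real.norm_of_nonneg (div_pos hSy hSz).le] at hn
    rw [← hn, one_smul] at h
    exact Subtype.ext h
  have hsurj : Function.Surjective G := by
    rintro ⟨x, hx⟩
    let d : EuclideanSpace ℝ (Fin (n + 1)) := WithLp.toLp 2 fun j => x (j, true) - x (j, false)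
    have hz : ∀ j, x (j, true) = 0 ∨ x (j, false) = 0 := fun j =>
      hx.1.2.2.2 (j, true) (j, false) (by simp) (by simp [octAdj])
    have hx0 := hx.1.1
    have hmx : ∀ j b, max (sg b * d j) 0 = x (j, b) := by
      intro j b
      have ht := hx0 (j, true)
      have hf := hx0 (j, false)
      rcases hz j with h | h <;> cases b <;> simp [d, sg, h, ht, hf]
    have hSd : S d = 1 := by
      have : ∑ p, x p = 1 := hx.2
      rw [Fintype.sum_prod_type] at this
      simp only [Fintype.sum_bool] at this
      rw [← this]
      refine Finset.sum_congr rfl fun j _ => ?_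
      have ht := hx0 (j, true)
      have hf := hx0 (j, false)
      rcases hz j with h | h <;> simp [d, h, abs_of_nonneg, ht, hf]
    have hd : d ≠ 0 := by
      intro h
      have : S d = 0 := by rw [h]; simp [S]
      linarith
    have hdn : 0 < ‖d‖ := norm_pos_iff.2 hd
    refine ⟨⟨‖d‖⁻¹ • d, by simp [norm_smul, hdn.ne']⟩, Subtype.ext ?_⟩
    funext p
    have hSn : S (‖d‖⁻¹ • d) = ‖d‖⁻¹ := by
      simp only [S, PiLp.smul_apply, smul_eq_mul, abs_mul, ← Finset.mul_sum]
      have : ∑ j, |d j| = 1 := hSd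
      rw [this, mul_one, abs_of_pos (inv_pos.2 hdn)]
    change max (sg p.2 * (‖d‖⁻¹ • d) p.1) 0 / S (‖d‖⁻¹ • d) = x p
    rw [hSn, ← hmx p.1 p.2]
    have : max (sg p.2 * (‖d‖⁻¹ • d) p.1) 0 = ‖d‖⁻¹ * max (sg p.2 * d p.1) 0 := by
      rw [mul_max_of_nonneg _ _ (inv_pos.2 hdn).le, mul_zero]
      simp only [PiLp.smul_apply, smul_eq_mul]
      congr 1
      ring
    rw [this]
    field_simp
  exact ⟨(Continuous.homeoOfEquivCompactToT2 (f := Equiv.ofBijective G ⟨hinj, hsurj⟩) hG).symm⟩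

lemma oct_exists {E : Type*} [NormedAddCommGroup E] [NormedSpace ℝ E] (n : ℕ)
    (ι : Fin (n + 1) × Bool → E) (hlin : LinearIndependent ℝ ι) :
    ∃ K : Geometry.SimplicialComplex ℝ E, K.faces.Finite ∧
      Nonempty (K.space ≃ₜ Metric.sphere (0 : EuclideanSpace ℝ (Fin (n + 1))) 1) ∧
      IsFlag (insert ∅ K.faces) ∧ fZero (insert ∅ K.faces) = 2 * n + 2 := by
  have hι : Function.Injective ι := hlin.injective
  let F : Set (Finset E) := {σ | ∃ τ ∈ octFaces n, σ = τ.image ι}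
  have hoctd : ∀ τ ∈ octFaces n, ∀ τ' ⊆ τ, τ' ∈ octFaces n :=
    fun τ hτ τ' h j hj => hτ j ⟨h hj.1, h hj.2⟩
  let K : Geometry.SimplicialComplex ℝ E := Geometry.SimplicialComplex.ofErase F
    (by
      rintro _ ⟨τ, _, rfl⟩
      refine (hlin.affineIndependent.range).mono ?_
      intro x hx
      obtain ⟨v, _, rfl⟩ := Finset.mem_image.1 (Finset.mem_coe.1 hx)
      exact ⟨v, rfl⟩)
    (by
      rintro _ σ' hσ' ⟨τ, hτ, rfl⟩
      obtain ⟨τ', hτ', rfl⟩ := Finset.subset_image_iff.1 hσ'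
      exact ⟨τ', hoctd τ hτ τ' hτ', rfl⟩)
    (by
      rintro _ ⟨τ, _, rfl⟩ _ ⟨τ', _, rfl⟩ p ⟨hp, hp'⟩
      rw [← Finset.coe_inter, ← Finset.image_inter _ _ hι, mem_hull_image ι hι]
      rw [mem_hull_image ι hι] at hp hp'
      obtain ⟨x, hx0, hx1, hx, hxp⟩ := hp
      obtain ⟨y, hy0, hy1, hy, hyp⟩ := hp'
      have hxy : x = y := by
        funext v
        have := Fintype.linearIndependent_iff.1 hlin (fun v => x v - y v) (by
          simp only [sub_smul]
          rw [Finset.sum_sub_distrib, hxp, hyp, sub_self]) v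
        exact sub_eq_zero.1 this
      refine ⟨x, hx0, hx1, fun v hv => ?_, hxp⟩
      by_cases h : v ∈ τ
      · rw [hxy]; exact hy v fun h' => hv (Finset.mem_inter.2 ⟨h, h'⟩)
      · exact hx v h)
  have hKf : K.faces = F \ {∅} := rfl
  have hA : insert ∅ K.faces = F := by
    ext σ
    simp only [hKf, Set.mem_insert_iff, Set.mem_sdiff, Set.mem_singleton_iff]
    constructor
    · rintro (rfl | h)
      · exact ⟨∅, fun j h => by simp at h, by simp⟩
      · exact h.1
    · intro h
      by_cases h0 : σ = ∅
      · exact Or.inl h0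
      · exact Or.inr ⟨h, h0⟩
  have hFcl : ∀ τ : Finset (Fin (n + 1) × Bool), τ.image ι ∈ F ↔ τ ∈ octFaces n := by
    intro τ
    constructor
    · rintro ⟨τ', hτ', h⟩
      rwa [Finset.image_injective hι h]
    · exact fun h => ⟨τ, h, rfl⟩
  have hsing : ∀ x : E, ({x} : Finset E) ∈ F ↔ ∃ v, ι v = x := by
    intro x
    constructor
    · rintro ⟨τ, _, h⟩
      have : x ∈ τ.image ι := by rw [← h]; exact Finset.mem_singleton_self x
      obtain ⟨v, _, hv⟩ := Finset.mem_image.1 this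
      exact ⟨v, hv⟩
    · rintro ⟨v, rfl⟩
      rw [← Finset.image_singleton, hFcl, oct_clique]
      intro u hu w hw huw
      exact absurd ((Finset.mem_singleton.1 hu).trans (Finset.mem_singleton.1 hw).symm) huw
  refine ⟨K, ?_, ?_, ?_, ?_⟩
  · rw [hKf]
    refine Set.Finite.sdiff (Set.Finite.subset (Set.finite_range
      fun τ : Finset (Fin (n + 1) × Bool) => τ.image ι) ?_)
    rintro _ ⟨τ, _, rfl⟩
    exact ⟨τ, rfl⟩
  · obtain ⟨H⟩ := oct_homeo n
    obtain ⟨H'⟩ := space_homeo (octAdj n) K ι hι (by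
      intro σ
      rw [hKf]
      constructor
      · rintro ⟨⟨τ, hτ, rfl⟩, h⟩
        exact ⟨Finset.nonempty_iff_ne_empty.2 h, τ, rfl, (oct_clique n τ).1 hτ⟩
      · rintro ⟨hne, τ, rfl, hτ⟩
        exact ⟨⟨τ, (oct_clique n τ).2 hτ, rfl⟩, hne.ne_empty⟩)
    exact ⟨H'.symm.trans H⟩
  · rw [hA]
    intro σ h1 h2
    have : σ ⊆ Finset.univ.image ι := by
      intro x hx
      obtain ⟨v, rfl⟩ := (hsing x).1 (h1 x hx)
      exact Finset.mem_image_of_mem _ (Finset.mem_univ v)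
    obtain ⟨τ, _, rfl⟩ := Finset.subset_image_iff.1 this
    rw [hFcl, oct_clique]
    intro u hu w hw huw
    have h := h2 (ι u) (Finset.mem_image_of_mem _ hu) (ι w) (Finset.mem_image_of_mem _ hw)
      (hι.ne huw)
    have e : ({ι u, ι w} : Finset E) = ({u, w} : Finset (Fin (n + 1) × Bool)).image ι := by
      simp [Finset.image_insert]
    rw [e, hFcl, oct_clique] at h
    exact h u (by simp) w (by simp) huw
  · rw [hA, fZero_eq_card F ι hι hsing]
    simp
    ring

lemma oct_exists_euclidean (n : ℕ) :
    ∃ (N : ℕ) (K : Geometry.SimplicialComplex ℝ (EuclideanSpace ℝ (Fin N))),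
        IsSphereTriangulation n K ∧ IsFlag (abstractFaces K) ∧
        fZero (abstractFaces K) = 2 * n + 2 := by
  let q := Fintype.equivFin (Fin (n + 1) × Bool)
  have h1 := (EuclideanSpace.basisFun
    (Fin (Fintype.card (Fin (n + 1) × Bool))) ℝ).toBasis.linearIndependent
  obtain ⟨K, h1, h2, h3, h4⟩ := oct_exists n _ (h1.comp q q.injective)
  exact ⟨_, K, ⟨h1, h2⟩, h3, h4⟩

/-- Every flag triangulation of the `n`-sphere has at least `2n+2` vertices, and up to
combinatorial isomorphism there is exactly one flag triangulation of `Sⁿ` with exactly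
`2n+2` vertices: the octahedral `n`-sphere. -/
theorem flag_sphere_min_vertices_octahedron (n : ℕ) :
    (∀ (N : ℕ) (K : Geometry.SimplicialComplex ℝ (EuclideanSpace ℝ (Fin N))),
        IsSphereTriangulation n K → IsFlag (abstractFaces K) →
        2 * n + 2 ≤ fZero (abstractFaces K)) ∧
      (∀ (N : ℕ) (K : Geometry.SimplicialComplex ℝ (EuclideanSpace ℝ (Fin N))),
        IsSphereTriangulation n K → IsFlag (abstractFaces K) →
        fZero (abstractFaces K) = 2 * n + 2 →
        CombIso (abstractFaces K) (octFaces n)) ∧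
      ∃ (N : ℕ) (K : Geometry.SimplicialComplex ℝ (EuclideanSpace ℝ (Fin N))),
        IsSphereTriangulation n K ∧ IsFlag (abstractFaces K) ∧
        fZero (abstractFaces K) = 2 * n + 2 ∧
        CombIso (abstractFaces K) (octFaces n) := by
  obtain ⟨N, K, h1, h2, h3⟩ := oct_exists_euclidean n
  have key : ∀ (N : ℕ) (K : Geometry.SimplicialComplex ℝ (EuclideanSpace ℝ (Fin N))),
      IsSphereTriangulation n K → IsFlag (abstractFaces K) →
      2 * n + 2 ≤ fZero (abstractFaces K) ∧
        (fZero (abstractFaces K) = 2 * n + 2 → CombIso (abstractFaces K) (octFaces n)) := by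
    rintro N K ⟨hfin, ⟨H⟩⟩ hF
    exact flag_main n K (abstractFaces K) rfl hfin H hF
  exact ⟨fun N K hS hF => (key N K hS hF).1, fun N K hS hF => (key N K hS hF).2,
    N, K, h1, h2, h3, (key N K h1 h2).2 h3⟩
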